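/- arXiv:2101.10316 — 2 statements merged into one kernel-verified Lean document; each statement's English description precedes it below -/
import Mathlib

section
/- For every integer n ≥ 38, the conjugator length function of Thompson's group F satisfies CLF(n) ≥ ((n − 15)² + 412)/128. -/
noncomputable section

open Set

noncomputable section

open Set

def x0fun : ℝ → ℝ := fun t =>
  if t < 0 then t
  else if t ≤ 1/2 then t / 2
  else if t ≤ 3/4 then t - 1/4
  else if t ≤ 1 then 2 * t - 1
  else t

def x0inv : ℝ → ℝ := fun t =>
  if t < 0 then t
  else if t ≤ 1/4 then 2 * t
  else if t ≤ 1/2 then t + 1/4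
  else if t ≤ 1 then (t + 1) / 2
  else t

/-- The generator `x₀` of Thompson's group `F`, as a permutation of `ℝ`
(the identity outside `[0,1]`). -/
def x0 : Equiv.Perm ℝ where
  toFun := x0fun
  invFun := x0inv
  left_inv := by
    intro t
    show x0inv (x0fun t) = t
    unfold x0fun
    split_ifs <;> (unfold x0inv; split_ifs <;> linarith)
  right_inv := by
    intro t
    show x0fun (x0inv t) = t
    unfold x0inv
    split_ifs <;> (unfold x0fun; split_ifs <;> linarith)

def x1fun : ℝ → ℝ := fun t =>
  if t < 0 then t
  else if t ≤ 1/2 then t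
  else if t ≤ 3/4 then t / 2 + 1/4
  else if t ≤ 7/8 then t - 1/8
  else if t ≤ 1 then 2 * t - 1
  else t

def x1inv : ℝ → ℝ := fun t =>
  if t < 0 then t
  else if t ≤ 1/2 then t
  else if t ≤ 5/8 then 2 * t - 1/2
  else if t ≤ 3/4 then t + 1/8
  else if t ≤ 1 then (t + 1) / 2
  else t

set_option maxHeartbeats 2000000 in
/-- The generator `x₁` of Thompson's group `F`, as a permutation of `ℝ`
(the identity outside `[0,1]`). -/
def x1 : Equiv.Perm ℝ where
  toFun := x1fun
  invFun := x1inv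
  left_inv := by
    intro t
    show x1inv (x1fun t) = t
    unfold x1fun
    split_ifs <;> (unfold x1inv; split_ifs <;> linarith)
  right_inv := by
    intro t
    show x1fun (x1inv t) = t
    unfold x1inv
    split_ifs <;> (unfold x1fun; split_ifs <;> linarith)

/-- Thompson's group `F`: the subgroup generated by `x₀` and `x₁`. -/
def ThompsonF : Subgroup (Equiv.Perm ℝ) :=
  Subgroup.closure ({x0, x1} : Set (Equiv.Perm ℝ))

/-- Word length with respect to the generating set `{x₀, x₁}`. -/
def wordLength (f : Equiv.Perm ℝ) : ℕ :=
  sInf {n | ∃ w : List (Equiv.Perm ℝ), w.length = n ∧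
    (∀ g ∈ w, g ∈ ({x0, x1, x0⁻¹, x1⁻¹} : Set (Equiv.Perm ℝ))) ∧ w.prod = f}
/-- Conjugator distance in Thompson's group `F` (the minimum word length of a conjugator). -/
def conjDist (f g : Equiv.Perm ℝ) : ℕ :=
  sInf {n | ∃ h ∈ ThompsonF, h⁻¹ * f * h = g ∧ wordLength h = n}

/-- The conjugator length function of Thompson's group `F`. -/
def CLF (n : ℕ) : ℕ :=
  sSup {m | ∃ f g : Equiv.Perm ℝ, f ∈ ThompsonF ∧ g ∈ ThompsonF ∧
    (∃ h ∈ ThompsonF, h⁻¹ * f * h = g) ∧ wordLength f + wordLength g ≤ n ∧ conjDist f g = m}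


/-! ### Words in the generators -/

/-- `f` is a product of `c` elements of `{x₀, x₁, x₀⁻¹, x₁⁻¹}`. -/
def HasWord (f : Equiv.Perm ℝ) (c : ℕ) : Prop :=
  ∃ w : List (Equiv.Perm ℝ), w.length = c ∧
    (∀ g ∈ w, g ∈ ({x0, x1, x0⁻¹, x1⁻¹} : Set (Equiv.Perm ℝ))) ∧ w.prod = f

theorem HasWord.of_mem {g : Equiv.Perm ℝ}
    (hg : g ∈ ({x0, x1, x0⁻¹, x1⁻¹} : Set (Equiv.Perm ℝ))) : HasWord g 1 :=
  ⟨[g], rfl, by simpa using hg, by simp⟩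

theorem hasWord_one : HasWord 1 0 := ⟨[], rfl, by simp, rfl⟩

theorem HasWord.mul {f g : Equiv.Perm ℝ} {c d : ℕ} (hf : HasWord f c) (hg : HasWord g d) :
    HasWord (f * g) (c + d) := by
  obtain ⟨v, rfl, hv, rfl⟩ := hf
  obtain ⟨w, rfl, hw, rfl⟩ := hg
  refine ⟨v ++ w, by simp, fun g hg => ?_, by simp⟩
  rcases List.mem_append.1 hg with h | h
  exacts [hv g h, hw g h]

theorem HasWord.pow {f : Equiv.Perm ℝ} {c : ℕ} (hf : HasWord f c) (m : ℕ) :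
    HasWord (f ^ m) (m * c) := by
  induction m with
  | zero => simpa using hasWord_one
  | succ m ih => simpa [pow_succ, add_mul] using ih.mul hf

theorem inv_mem_generators {g : Equiv.Perm ℝ}
    (hg : g ∈ ({x0, x1, x0⁻¹, x1⁻¹} : Set (Equiv.Perm ℝ))) :
    g⁻¹ ∈ ({x0, x1, x0⁻¹, x1⁻¹} : Set (Equiv.Perm ℝ)) := by
  simp only [mem_insert_iff, mem_singleton_iff] at hg ⊢
  rcases hg with rfl | rfl | rfl | rfl <;> simp

theorem HasWord.inv {f : Equiv.Perm ℝ} {c : ℕ} (hf : HasWord f c) : HasWord f⁻¹ c := by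
  obtain ⟨w, rfl, hw, rfl⟩ := hf
  refine ⟨(w.map (·⁻¹)).reverse, by simp, fun g hg => ?_, by rw [List.prod_inv_reverse]⟩
  obtain ⟨a, ha, rfl⟩ : ∃ a ∈ w, a⁻¹ = g := by simpa using hg
  exact inv_mem_generators (hw a ha)

theorem HasWord.wordLength_le {f : Equiv.Perm ℝ} {c : ℕ} (hf : HasWord f c) :
    wordLength f ≤ c := Nat.sInf_le hf

theorem HasWord.mem {f : Equiv.Perm ℝ} {c : ℕ} (hf : HasWord f c) : f ∈ ThompsonF := by
  obtain ⟨w, -, hw, rfl⟩ := hf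
  refine Subgroup.list_prod_mem _ fun g hg => ?_
  have h0 : x0 ∈ ThompsonF := Subgroup.subset_closure (by simp)
  have h1 : x1 ∈ ThompsonF := Subgroup.subset_closure (by simp)
  have := hw g hg
  simp only [mem_insert_iff, mem_singleton_iff] at this
  rcases this with rfl | rfl | rfl | rfl
  exacts [h0, h1, inv_mem h0, inv_mem h1]

theorem hasWord_wordLength {f : Equiv.Perm ℝ} (hf : f ∈ ThompsonF) :
    HasWord f (wordLength f) := by
  have key : ∃ c, HasWord f c := by
    induction hf using Subgroup.closure_induction with
    | mem g hg =>
      refine ⟨1, .of_mem ?_⟩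
      rcases hg with rfl | rfl <;> simp
    | one => exact ⟨0, hasWord_one⟩
    | mul f g _ _ hf hg =>
      obtain ⟨c, hc⟩ := hf
      obtain ⟨d, hd⟩ := hg
      exact ⟨c + d, hc.mul hd⟩
    | inv f _ hf => exact hf.imp fun _ h => h.inv
  exact Nat.sInf_mem key

theorem finite_wordLength_le (n : ℕ) : {f | f ∈ ThompsonF ∧ wordLength f ≤ n}.Finite := by
  let A : Set (Equiv.Perm ℝ) := {x0, x1, x0⁻¹, x1⁻¹}
  have hA : Finite A := Set.toFinite A
  refine ((List.finite_length_le A n).image fun w => (w.map Subtype.val).prod).subset ?_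
  rintro f ⟨hf, hn⟩
  obtain ⟨w, hc, hw, rfl⟩ := hasWord_wordLength hf
  lift w to List A using hw
  exact ⟨w, (by simpa using hc.trans_le hn : w.length ≤ n), rfl⟩

theorem le_CLF {n : ℕ} {f g : Equiv.Perm ℝ} (hf : f ∈ ThompsonF) (hg : g ∈ ThompsonF)
    (hfg : ∃ h ∈ ThompsonF, h⁻¹ * f * h = g) (hn : wordLength f + wordLength g ≤ n) :
    conjDist f g ≤ CLF n := by
  refine le_csSup ?_ ⟨f, g, hf, hg, hfg, hn, rfl⟩
  have hfin := (finite_wordLength_le n).prod (finite_wordLength_le n)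
  refine ((hfin.image fun q => conjDist q.1 q.2).subset ?_).bddAbove
  rintro _ ⟨f, g, hf, hg, -, hn, rfl⟩
  exact ⟨(f, g), ⟨⟨hf, (Nat.le_add_right _ _).trans hn⟩,
    ⟨hg, (Nat.le_add_left _ _).trans hn⟩⟩, rfl⟩

/-! ### The model of `F` on the real line -/

/-- The piecewise linear embedding of `ℝ` into `[0,1]` that carries the translation `t ↦ t - 1`
to `x₀`. -/
def lineEmb (t : ℝ) : ℝ :=
  if 0 ≤ t then 1 - 2 ^ (-⌊t⌋ - 2) * (2 - Int.fract t) else 2 ^ (⌊t⌋ - 1) * (1 + Int.fract t)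

/-- The action of `x₀` on the line. -/
def y0 : Equiv.Perm ℝ where
  toFun t := t - 1
  invFun t := t + 1
  left_inv t := by ring
  right_inv t := by ring

/-- The action of `x₁` on the line. -/
def y1 : Equiv.Perm ℝ where
  toFun t := if t < 0 then t else if t < 2 then t / 2 else t - 1
  invFun t := if t < 0 then t else if t < 1 then 2 * t else t + 1
  left_inv t := by dsimp only; split_ifs <;> linarith
  right_inv t := by dsimp only; split_ifs <;> linarith

theorem y0_apply (t : ℝ) : y0 t = t - 1 := rfl

theorem y0_inv_apply (t : ℝ) : y0⁻¹ t = t + 1 := rfl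

theorem y1_apply (t : ℝ) : y1 t = if t < 0 then t else if t < 2 then t / 2 else t - 1 := rfl

theorem y1_inv_apply (t : ℝ) :
    y1⁻¹ t = if t < 0 then t else if t < 1 then 2 * t else t + 1 := rfl

theorem lineEmb_of_neg {t : ℝ} (ht : t < 0) :
    lineEmb t = 2 ^ (⌊t⌋ - 1) * (1 + Int.fract t) := if_neg (not_le.2 ht)

theorem lineEmb_of_nonneg {t : ℝ} (ht : 0 ≤ t) :
    lineEmb t = 1 - 2 ^ (-⌊t⌋ - 2) * (2 - Int.fract t) := if_pos ht

theorem lineEmb_of_mem_Ico {t : ℝ} (h0 : 0 ≤ t) (h1 : t < 1) : lineEmb t = 1 / 2 + t / 4 := by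
  have : ⌊t⌋ = 0 := Int.floor_eq_zero_iff.2 ⟨h0, h1⟩
  rw [lineEmb_of_nonneg h0, Int.fract, this]
  norm_num
  ring

theorem lineEmb_lt_half {t : ℝ} (ht : t < 0) : 0 ≤ lineEmb t ∧ lineEmb t < 1 / 2 := by
  rw [lineEmb_of_neg ht]
  have h1 := Int.fract_nonneg t
  have h2 := Int.fract_lt_one t
  have h3 : ⌊t⌋ - 1 ≤ -2 := by
    have : ⌊t⌋ < 0 := Int.floor_lt.2 (by simpa using ht)
    omega
  have h4 : (2 : ℝ) ^ (⌊t⌋ - 1) ≤ 2 ^ (-2 : ℤ) := zpow_le_zpow_right₀ one_le_two h3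
  have h5 : (0 : ℝ) < 2 ^ (⌊t⌋ - 1) := by positivity
  norm_num at h4
  exact ⟨by positivity, by nlinarith⟩

theorem lineEmb_bounds {t : ℝ} (m : ℕ) (ht : m ≤ t) :
    1 - 1 / 2 ^ (m + 1) ≤ lineEmb t ∧ lineEmb t < 1 := by
  rw [lineEmb_of_nonneg (le_trans (Nat.cast_nonneg m) ht)]
  have h1 := Int.fract_nonneg t
  have h2 := Int.fract_lt_one t
  have h3 : -⌊t⌋ - 2 ≤ -(m + 2 : ℕ) := by
    have : (m : ℤ) ≤ ⌊t⌋ := Int.le_floor.2 (by simpa using ht)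
    push_cast
    omega
  have h4 : (2 : ℝ) ^ (-⌊t⌋ - 2) ≤ 2 ^ (-(m + 2 : ℕ) : ℤ) := zpow_le_zpow_right₀ one_le_two h3
  have h5 : (0 : ℝ) < 2 ^ (-⌊t⌋ - 2) := by positivity
  rw [zpow_neg, zpow_natCast] at h4
  have h6 : (1 : ℝ) / 2 ^ (m + 1) = 2 * (2 ^ (m + 2))⁻¹ := by
    rw [pow_succ 2 (m + 1)]
    field_simp
  rw [h6]
  exact ⟨by nlinarith, by nlinarith⟩

theorem lineEmb_sub_one_of_neg {t : ℝ} (ht : t < 0) : lineEmb (t - 1) = lineEmb t / 2 := by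
  rw [lineEmb_of_neg ht, lineEmb_of_neg (by linarith), Int.fract_sub_one, Int.floor_sub_one,
    zpow_sub_one₀ two_ne_zero (⌊t⌋ - 1)]
  ring

theorem lineEmb_sub_one_of_one_le {t : ℝ} (ht : 1 ≤ t) :
    lineEmb (t - 1) = 2 * lineEmb t - 1 := by
  have : -(⌊t⌋ - 1) - 2 = -⌊t⌋ - 2 + 1 := by ring
  rw [lineEmb_of_nonneg (by linarith), lineEmb_of_nonneg (by linarith), Int.fract_sub_one,
    Int.floor_sub_one, this, zpow_add_one₀ two_ne_zero]
  ring

/-- `G` describes the action of `g` on the line. -/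
def LineAction (g G : Equiv.Perm ℝ) : Prop := ∀ t, g (lineEmb t) = lineEmb (G t)

theorem lineAction_one : LineAction 1 1 := fun _ => rfl

theorem LineAction.mul {f F g G : Equiv.Perm ℝ} (hf : LineAction f F) (hg : LineAction g G) :
    LineAction (f * g) (F * G) := fun t => by
  rw [Equiv.Perm.mul_apply, hg, hf, Equiv.Perm.mul_apply]

theorem LineAction.inv {g G : Equiv.Perm ℝ} (hg : LineAction g G) : LineAction g⁻¹ G⁻¹ :=
  fun t => by rw [Equiv.Perm.inv_eq_iff_eq, hg, ← Equiv.Perm.mul_apply, mul_inv_cancel,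
    Equiv.Perm.one_apply]

theorem LineAction.pow {g G : Equiv.Perm ℝ} (hg : LineAction g G) (m : ℕ) :
    LineAction (g ^ m) (G ^ m) := by
  induction m with
  | zero => exact lineAction_one
  | succ m ih => simpa only [pow_succ] using ih.mul hg

theorem LineAction.zpow {g G : Equiv.Perm ℝ} (hg : LineAction g G) (m : ℤ) :
    LineAction (g ^ m) (G ^ m) := by
  cases m with
  | ofNat m => simpa using hg.pow m
  | negSucc m => simpa using (hg.pow (m + 1)).inv

theorem lineAction_x0 : LineAction x0 y0 := by
  intro t
  rw [y0_apply]
  change x0fun _ = _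
  unfold x0fun
  rcases lt_or_ge t 0 with h | h
  · obtain ⟨h1, h2⟩ := lineEmb_lt_half h
    rw [if_neg (by linarith), if_pos h2.le, lineEmb_sub_one_of_neg h]
  rcases lt_or_ge t 1 with h' | h'
  · have e : lineEmb (t - 1) = 1 / 4 + t / 4 := by
      have : ⌊t - 1⌋ = -1 := Int.floor_eq_iff.2 ⟨by push_cast; linarith, by push_cast; linarith⟩
      rw [lineEmb_of_neg (by linarith), Int.fract, this]
      norm_num
      ring
    rw [e, lineEmb_of_mem_Ico h h']
    split_ifs <;> linarith
  · obtain ⟨h1, h2⟩ := lineEmb_bounds 1 (t := t) (by simpa using h')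
    norm_num at h1
    rw [lineEmb_sub_one_of_one_le h']
    split_ifs <;> linarith

theorem lineAction_x1 : LineAction x1 y1 := by
  intro t
  rw [y1_apply]
  change x1fun _ = _
  unfold x1fun
  rcases lt_or_ge t 0 with h | h
  · obtain ⟨h1, h2⟩ := lineEmb_lt_half h
    rw [if_neg (by linarith), if_pos h2.le, if_pos h]
  rcases lt_or_ge t 2 with h' | h'
  · rw [if_neg h.not_gt, if_pos h', lineEmb_of_mem_Ico (t := t / 2) (by linarith) (by linarith)]
    rcases lt_or_ge t 1 with h1 | h1
    · rw [lineEmb_of_mem_Ico h h1]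
      split_ifs <;> linarith
    · have e : lineEmb t = 5 / 8 + t / 8 := by
        have := lineEmb_sub_one_of_one_le h1
        rw [lineEmb_of_mem_Ico (by linarith) (by linarith)] at this
        linarith
      rw [e]
      split_ifs <;> linarith
  · obtain ⟨h1, h2⟩ := lineEmb_bounds 2 (t := t) (by simpa using h')
    norm_num at h1
    rw [if_neg h.not_gt, if_neg h'.not_gt, lineEmb_sub_one_of_one_le (by linarith)]
    split_ifs <;> linarith

theorem y0_zpow_apply (m : ℤ) (t : ℝ) : (y0 ^ m) t = t - m := by
  have h (i : ℕ) (t : ℝ) : (y0 ^ i) t = t - i := by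
    induction i generalizing t with
    | zero => simp
    | succ i ih =>
      rw [pow_succ, Equiv.Perm.mul_apply, ih, y0_apply]
      push_cast
      ring
  cases m with
  | ofNat i => simpa using h i t
  | negSucc i =>
    rw [zpow_negSucc, Equiv.Perm.inv_eq_iff_eq, h]
    push_cast
    ring

theorem lineEmb_injective : Function.Injective lineEmb := by
  intro a b hab
  have h := lineAction_x0.zpow ⌊a⌋
  have e := h a
  rw [hab, h b, y0_zpow_apply, y0_zpow_apply] at e
  have h0 : 0 ≤ a - ⌊a⌋ := Int.fract_nonneg a
  have h1 : a - ⌊a⌋ < 1 := Int.fract_lt_one a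
  rw [lineEmb_of_mem_Ico h0 h1] at e
  have hb0 : 0 ≤ b - ⌊a⌋ := by
    by_contra! hb
    linarith [(lineEmb_lt_half hb).2]
  have hb1 : b - ⌊a⌋ < 1 := by
    by_contra! hb
    have := (lineEmb_bounds 1 (t := b - ⌊a⌋) (by simpa using hb)).1
    norm_num at this
    linarith
  rw [lineEmb_of_mem_Ico hb0 hb1] at e
  linarith

theorem LineAction.unique {g G G' : Equiv.Perm ℝ} (h₁ : LineAction g G) (h₂ : LineAction g G') :
    G = G' := by
  ext t
  exact lineEmb_injective ((h₁ t).symm.trans (h₂ t))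

/-! ### Right slopes and their variation -/

/-- To the right of `t`, the function `G` is affine with slope `2 ^ s`. -/
def HasRightSlope (G : ℝ → ℝ) (t : ℝ) (s : ℤ) : Prop :=
  ∃ ε > 0, ∀ u, 0 ≤ u → u < ε → G (t + u) = G t + 2 ^ s * u

theorem HasRightSlope.unique {G : ℝ → ℝ} {t : ℝ} {r s : ℤ} (hr : HasRightSlope G t r)
    (hs : HasRightSlope G t s) : r = s := by
  obtain ⟨ε, hε, h⟩ := hr
  obtain ⟨δ, hδ, h'⟩ := hs
  have hm : 0 < min ε δ := lt_min hε hδ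
  have e1 := h (min ε δ / 2) (by linarith) (by linarith [min_le_left ε δ])
  have e2 := h' (min ε δ / 2) (by linarith) (by linarith [min_le_right ε δ])
  have e3 : (2 : ℝ) ^ r = 2 ^ s := mul_right_cancel₀ (half_pos hm).ne' (by linarith)
  exact zpow_right_injective₀ (by norm_num) (by norm_num) e3

theorem HasRightSlope.comp {F G : ℝ → ℝ} {t : ℝ} {r s : ℤ} (hF : HasRightSlope F (G t) r)
    (hG : HasRightSlope G t s) : HasRightSlope (F ∘ G) t (r + s) := by
  obtain ⟨ε, hε, h⟩ := hF
  obtain ⟨δ, hδ, h'⟩ := hG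
  have h2 : (0 : ℝ) < 2 ^ s := by positivity
  refine ⟨min δ (ε / 2 ^ s), lt_min hδ (div_pos hε h2), fun u hu hlt => ?_⟩
  have h3 : 2 ^ s * u < ε := by
    have := (lt_div_iff₀ h2).1 (hlt.trans_le (min_le_right _ _))
    linarith
  rw [Function.comp_apply, Function.comp_apply, h' u hu (hlt.trans_le (min_le_left _ _)),
    h _ (by positivity) h3, zpow_add₀ two_ne_zero]
  ring

/-- `G` is a strictly increasing map of the line with right slopes powers of two whose logarithms
have variation at most `2 * c`, and is a translation near `+∞`. -/
def LineModel (G : Equiv.Perm ℝ) (c : ℕ) : Prop :=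
  StrictMono G ∧ (∃ a b : ℝ, ∀ t, b ≤ t → G t = t + a) ∧
    ∃ s : ℝ → ℤ, (∀ t, HasRightSlope G t (s t)) ∧
      ∀ (p : ℕ → ℝ), Monotone p → ∀ N : ℕ,
        ∑ i ∈ Finset.range N, |s (p (i + 1)) - s (p i)| ≤ 2 * (c : ℤ)

theorem lineModel_one : LineModel 1 0 :=
  ⟨strictMono_id, ⟨0, 0, fun t _ => by simp⟩, 0, fun t => ⟨1, one_pos, fun u _ _ => by simp⟩,
    fun p _ N => by simp⟩

theorem LineModel.mul {F G : Equiv.Perm ℝ} {c d : ℕ} (hF : LineModel F c) (hG : LineModel G d) :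
    LineModel (F * G) (c + d) := by
  obtain ⟨mF, ⟨a, b, tF⟩, r, hr, vF⟩ := hF
  obtain ⟨mG, ⟨a', b', tG⟩, s, hs, vG⟩ := hG
  refine ⟨mF.comp mG, ⟨a' + a, max b' (b - a'), fun t ht => ?_⟩, fun t => r (G t) + s t,
    fun t => (hr (G t)).comp (hs t), fun p hp N => ?_⟩
  · have h1 := (le_max_left _ _).trans ht
    have h2 := (le_max_right _ _).trans ht
    rw [Equiv.Perm.mul_apply, tG t h1, tF _ (by linarith)]
    ring
  · have h1 := vF (fun i => G (p i)) (mG.monotone.comp hp) N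
    have h2 := vG p hp N
    calc _ ≤ ∑ i ∈ Finset.range N,
            (|r (G (p (i + 1))) - r (G (p i))| + |s (p (i + 1)) - s (p i)|) :=
          Finset.sum_le_sum fun i _ => by
            rw [add_sub_add_comm]
            exact abs_add_le _ _
      _ ≤ _ := by
          rw [Finset.sum_add_distrib]
          push_cast
          linarith

theorem sum_abs_sub_of_step (a : ℝ) {p : ℕ → ℝ} (hp : Monotone p) (N : ℕ) :
    ∑ i ∈ Finset.range N, |(if p (i + 1) < a then (0 : ℤ) else 1) - (if p i < a then 0 else 1)|
      ≤ 1 := by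
  have h (i : ℕ) : |(if p (i + 1) < a then (0 : ℤ) else 1) - (if p i < a then 0 else 1)|
      = (if p (i + 1) < a then (0 : ℤ) else 1) - (if p i < a then 0 else 1) := by
    have : p i ≤ p (i + 1) := hp (Nat.le_succ i)
    refine abs_of_nonneg ?_
    split_ifs <;> first | (exfalso; linarith) | norm_num
  simp_rw [h]
  rw [Finset.sum_range_sub fun i => if p i < a then (0 : ℤ) else 1]
  split_ifs <;> norm_num

/-- The function equal to `e` on `[a, b)` and to `0` elsewhere. -/
def bump (e : ℤ) (a b t : ℝ) : ℤ := e * ((if t < a then 0 else 1) - (if t < b then 0 else 1))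

theorem sum_abs_sub_bump_le {e : ℤ} (he : |e| = 1) (a b : ℝ) {p : ℕ → ℝ} (hp : Monotone p)
    (N : ℕ) :
    ∑ i ∈ Finset.range N, |bump e a b (p (i + 1)) - bump e a b (p i)| ≤ 2 * ((1 : ℕ) : ℤ) := by
  have h1 := sum_abs_sub_of_step a hp N
  have h2 := sum_abs_sub_of_step b hp N
  refine (Finset.sum_le_sum fun i _ => ?_).trans
    ((Finset.sum_add_distrib.le).trans ((add_le_add h1 h2).trans (by norm_num)))
  rw [bump, bump, ← mul_sub, abs_mul, he, one_mul, sub_sub_sub_comm]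
  exact abs_sub _ _

theorem LineModel.translation {G : Equiv.Perm ℝ} {a : ℝ} (hG : ∀ t, G t = t + a) :
    LineModel G 1 :=
  ⟨fun s t h => by simpa [hG] using h, ⟨a, 0, fun t _ => hG t⟩, 0,
    fun t => ⟨1, one_pos, fun u _ _ => by simp [hG]; ring⟩, fun p _ N => by simp⟩

theorem lineModel_y1 : LineModel y1 1 := by
  refine ⟨fun s t h => ?_, ⟨-1, 2, fun t ht => ?_⟩,
    bump (-1) 0 2, fun t => ?_,
    fun p hp N => sum_abs_sub_bump_le (by norm_num) 0 2 hp N⟩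
  · rw [y1_apply, y1_apply]
    split_ifs <;> linarith
  · rw [y1_apply, if_neg (by linarith), if_neg (by linarith)]
    ring
  · unfold bump
    rcases lt_or_ge t 0 with h | h
    · refine ⟨-t, by linarith, fun u _ h' => ?_⟩
      rw [y1_apply, y1_apply, if_pos h, if_pos (by linarith), if_pos h, if_pos (by linarith)]
      simp
    rcases lt_or_ge t 2 with h2 | h2
    · refine ⟨2 - t, by linarith, fun u _ h' => ?_⟩
      rw [y1_apply, y1_apply, if_neg h.not_gt, if_neg (by linarith), if_neg h.not_gt, if_pos h2,
        if_pos h2, if_pos (by linarith)]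
      norm_num
      ring
    · refine ⟨1, one_pos, fun u _ h' => ?_⟩
      rw [y1_apply, y1_apply, if_neg h.not_gt, if_neg (by linarith), if_neg h.not_gt,
        if_neg h2.not_gt, if_neg h2.not_gt, if_neg (by linarith)]
      norm_num
      ring

theorem lineModel_y1_inv : LineModel y1⁻¹ 1 := by
  refine ⟨fun s t h => ?_, ⟨1, 1, fun t ht => ?_⟩,
    bump 1 0 1, fun t => ?_,
    fun p hp N => sum_abs_sub_bump_le (by norm_num) 0 1 hp N⟩
  · rw [y1_inv_apply, y1_inv_apply]
    split_ifs <;> linarith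
  · rw [y1_inv_apply, if_neg (by linarith), if_neg (by linarith)]
  · unfold bump
    rcases lt_or_ge t 0 with h | h
    · refine ⟨-t, by linarith, fun u _ h' => ?_⟩
      rw [y1_inv_apply, y1_inv_apply, if_pos h, if_pos (by linarith), if_pos h,
        if_pos (by linarith)]
      simp
    rcases lt_or_ge t 1 with h2 | h2
    · refine ⟨1 - t, by linarith, fun u _ h' => ?_⟩
      rw [y1_inv_apply, y1_inv_apply, if_neg h.not_gt, if_neg (by linarith), if_neg h.not_gt,
        if_pos h2, if_pos h2, if_pos (by linarith)]
      norm_num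
      ring
    · refine ⟨1, one_pos, fun u _ h' => ?_⟩
      rw [y1_inv_apply, y1_inv_apply, if_neg h.not_gt, if_neg (by linarith), if_neg h.not_gt,
        if_neg h2.not_gt, if_neg h2.not_gt, if_neg (by linarith)]
      norm_num
      ring

theorem HasWord.exists_lineModel {f : Equiv.Perm ℝ} {c : ℕ} (hf : HasWord f c) :
    ∃ F, LineAction f F ∧ LineModel F c := by
  obtain ⟨w, rfl, hw, rfl⟩ := hf
  induction w with
  | nil => exact ⟨1, lineAction_one, lineModel_one⟩
  | cons g w ih =>
    obtain ⟨W, hW, mW⟩ := ih fun a ha => hw a (List.mem_cons_of_mem _ ha)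
    obtain ⟨G, hG, mG⟩ : ∃ G, LineAction g G ∧ LineModel G 1 := by
      have := hw g List.mem_cons_self
      simp only [mem_insert_iff, mem_singleton_iff] at this
      rcases this with rfl | rfl | rfl | rfl
      exacts [⟨y0, lineAction_x0, .translation (a := -1) fun t => sub_eq_add_neg t 1⟩,
        ⟨y1, lineAction_x1, lineModel_y1⟩,
        ⟨y0⁻¹, lineAction_x0.inv, .translation (a := 1) y0_inv_apply⟩,
        ⟨y1⁻¹, lineAction_x1.inv, lineModel_y1_inv⟩]
    refine ⟨G * W, by simpa using hG.mul hW, ?_⟩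
    rw [List.length_cons, add_comm]
    exact mG.mul mW

/-! ### Products of commuting shifts -/

section Shifts

variable {G : Type*} [Group G]

/-- The conjugate of `a` by the `i`-th power of `S`. -/
def shift (S a : G) (i : ℕ) : G := (S ^ i)⁻¹ * a * S ^ i

/-- The indices `j + l + 1` with `j, l < k`. -/
def tentIndices (k : ℕ) : List ℕ :=
  (List.range k).flatMap fun j => (List.range k).map fun l => j + l + 1

/-- The product of the shifts of `a` with indices in `tentIndices k`. -/
def tent (S a : G) (k : ℕ) : G := ((tentIndices k).map (shift S a)).prod

theorem prod_shift_range (S a : G) (j k : ℕ) :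
    ((List.range k).map fun l => shift S a (j + l + 1)).prod =
      shift S ((S⁻¹ * a) ^ k * S ^ k) j := by
  induction k with
  | zero => simp [shift]
  | succ k ih =>
    rw [List.range_succ, List.map_append, List.prod_append, ih]
    simp only [shift, List.map_cons, List.map_nil, List.prod_cons, List.prod_nil, pow_succ,
      pow_add]
    group

theorem prod_shift_conj (S c : G) (m : ℕ) :
    S⁻¹ * ((List.range m).map (shift S c)).prod * S =
      c⁻¹ * ((List.range m).map (shift S c)).prod * shift S c m := by
  induction m with
  | zero => simp [shift]
  | succ m ih =>
    rw [List.range_succ, List.map_append, List.prod_append]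
    set h := ((List.range m).map (shift S c)).prod
    have e : S⁻¹ * shift S c m * S = shift S c (m + 1) := by
      simp only [shift, pow_succ]
      group
    have : S⁻¹ * (h * shift S c m) * S = (S⁻¹ * h * S) * (S⁻¹ * shift S c m * S) := by group
    simp only [List.map_cons, List.map_nil, List.prod_cons, List.prod_nil, mul_one]
    rw [this, ih, e]
    group

theorem tent_eq (S a : G) (k : ℕ) :
    tent S a k = ((List.range k).map (shift S ((S⁻¹ * a) ^ k * S ^ k))).prod := by
  rw [tent, tentIndices, List.map_flatMap, List.flatMap_def, List.prod_flatten, List.map_map]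
  congr 1
  refine List.map_congr_left fun j _ => ?_
  rw [Function.comp_apply, List.map_map, ← prod_shift_range]
  rfl

theorem tent_conj (S a : G) (hS : ∀ i j, Commute (shift S a i) (shift S a j)) (m : ℕ) :
    tent S a (m + 1) * S * (tent S a (m + 1))⁻¹ =
      (S⁻¹) ^ m * (S⁻¹ * a) ^ (m + 1) * S ^ (m + 1) * ((S⁻¹ * a)⁻¹) ^ (m + 1) := by
  set c := (S⁻¹ * a) ^ (m + 1) * S ^ (m + 1) with hc
  have hcomm (i j : ℕ) : Commute (shift S c i) (shift S c j) := by
    rw [hc, ← prod_shift_range, ← prod_shift_range]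
    refine Commute.list_prod_left _ _ fun x hx => Commute.list_prod_right _ _ fun y hy => ?_
    obtain ⟨l, -, rfl⟩ := List.mem_map.1 hx
    obtain ⟨l', -, rfl⟩ := List.mem_map.1 hy
    exact hS _ _
  have ht (j : ℕ) : Commute (tent S a (m + 1)) (shift S c j) := by
    rw [tent_eq]
    refine Commute.list_prod_left _ _ fun x hx => ?_
    obtain ⟨l, -, rfl⟩ := List.mem_map.1 hx
    exact hcomm _ _
  have h0 : shift S c 0 = c := by simp [shift]
  have key := prod_shift_conj S c (m + 1)
  rw [← tent_eq] at key
  set h := tent S a (m + 1)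
  have e1 : h * shift S c (m + 1) = shift S c (m + 1) * h := ht _
  have e2 : c⁻¹ * shift S c (m + 1) = shift S c (m + 1) * c⁻¹ := by
    have := hcomm 0 (m + 1)
    rw [h0] at this
    exact this.inv_left
  have e3 : h * S * h⁻¹ = S * (S⁻¹ * h * S) * h⁻¹ := by group
  rw [e3, key, mul_assoc c⁻¹, e1, ← mul_assoc c⁻¹, e2, hc, shift]
  generalize S⁻¹ * a = B
  group

theorem mul_eq_mul_of_conj {S g h : G} (hc : h⁻¹ * (g * S * g⁻¹) * h = S) :
    g⁻¹ * h * S = S * (g⁻¹ * h) := by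
  rw [mul_assoc, inv_mul_eq_iff_eq_mul] at hc
  rw [mul_assoc, ← hc]
  group

theorem length_tentIndices (k : ℕ) : (tentIndices k).length = k * k := by
  simp [tentIndices, List.length_flatMap]

theorem mem_tentIndices {k i : ℕ} (h : i ∈ tentIndices k) : 0 < i ∧ i < 2 * k := by
  simp only [tentIndices, List.mem_flatMap, List.mem_map, List.mem_range] at h
  omega

end Shifts

/-! ### The conjugate elements -/

/-- An element supported on `[1/4, 3/4]`. -/
def psi : Equiv.Perm ℝ := x0 * x1 * x0⁻¹ * x1⁻¹

/-- The action of `psi` on the line, supported on `[-1, 1]`. -/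
def linePsi : Equiv.Perm ℝ := y0 * y1 * y0⁻¹ * y1⁻¹

theorem lineAction_psi : LineAction psi linePsi :=
  ((lineAction_x0.mul lineAction_x1).mul lineAction_x0.inv).mul lineAction_x1.inv

theorem linePsi_apply (t : ℝ) : linePsi t =
    if t < -1 then t else if t < 0 then (t - 1) / 2 else if t < 1 / 2 then t - 1 / 2 else
      if t < 1 then 2 * t - 1 else t := by
  simp only [linePsi, Equiv.Perm.mul_apply, y0_apply, y1_apply, y0_inv_apply, y1_inv_apply]
  split_ifs <;> linarith

theorem x0_lt_quarter {t : ℝ} (ht : t < 1 / 2) : x0 t < 1 / 4 := by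
  change x0fun t < _
  unfold x0fun
  split_ifs <;> linarith

theorem psi_eq_self {t : ℝ} (ht : t < 1 / 4 ∨ 3 / 4 ≤ t) : psi t = t := by
  change x0fun (x1fun (x0inv (x1inv t))) = t
  rcases ht with ht | ht
  · have e : x1inv t = t := by unfold x1inv; split_ifs <;> linarith
    rw [e]
    have e2 : x0inv t ≤ 1 / 2 := by unfold x0inv; split_ifs <;> linarith
    have e3 : x1fun (x0inv t) = x0inv t := by unfold x1fun; split_ifs <;> linarith
    rw [e3]
    exact x0.right_inv t
  · have e : x1inv t = x0inv t := by unfold x1inv x0inv; split_ifs <;> linarith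
    have e1 : 7 / 8 ≤ x0inv t := by unfold x0inv; split_ifs <;> linarith
    have e2 : 7 / 8 ≤ x0inv (x0inv t) := by
      generalize x0inv t = r at e1
      unfold x0inv
      split_ifs <;> linarith
    have e3 : x1fun (x0inv (x0inv t)) = x0fun (x0inv (x0inv t)) := by
      unfold x1fun x0fun
      split_ifs <;> linarith
    rw [e, e3]
    have h1 : x0fun (x0inv (x0inv t)) = x0inv t := x0.right_inv _
    have h2 : x0fun (x0inv t) = t := x0.right_inv _
    rw [h1, h2]

theorem pow_x0_sq_lt {t : ℝ} (ht : t < 3 / 4) (i : ℕ) : ((x0 ^ 2) ^ (i + 1)) t < 1 / 4 := by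
  have h1 : x0 t < 1 / 2 := by
    change x0fun t < _
    unfold x0fun
    split_ifs <;> linarith
  induction i with
  | zero => simpa [pow_two] using x0_lt_quarter h1
  | succ i ih =>
    rw [pow_succ', Equiv.Perm.mul_apply, pow_two, Equiv.Perm.mul_apply]
    have := x0_lt_quarter (ih.trans (by norm_num))
    exact x0_lt_quarter (this.trans (by norm_num))

theorem commute_shift_psi (i j : ℕ) : Commute (shift (x0 ^ 2) psi i) (shift (x0 ^ 2) psi j) := by
  wlog hij : i < j generalizing i j
  · rcases (not_lt.1 hij).lt_or_eq with h | rfl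
    · exact (this j i h).symm
    · exact Commute.refl _
  have fix {l : ℕ} {t : ℝ} (h : psi (((x0 ^ 2) ^ l) t) = ((x0 ^ 2) ^ l) t) :
      shift (x0 ^ 2) psi l t = t := by
    rw [shift, Equiv.Perm.mul_apply, Equiv.Perm.mul_apply, h, Equiv.Perm.inv_eq_iff_eq]
  refine Equiv.Perm.Disjoint.commute fun t => ?_
  rcases lt_or_ge (((x0 ^ 2) ^ i) t) (3 / 4) with h | h
  · right
    obtain ⟨d, rfl⟩ := Nat.exists_eq_add_of_lt hij
    refine fix (psi_eq_self (.inl ?_))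
    have e : (x0 ^ 2) ^ (i + d + 1) = (x0 ^ 2) ^ (d + 1) * (x0 ^ 2) ^ i := by
      rw [← pow_add]
      congr 1
      omega
    rw [e, Equiv.Perm.mul_apply]
    exact pow_x0_sq_lt h d
  · exact .inl (fix (psi_eq_self (.inr h)))

theorem y0_sq_pow_apply (i : ℕ) (t : ℝ) : ((y0 ^ 2) ^ i) t = t - 2 * i := by
  rw [← pow_mul, ← zpow_natCast, y0_zpow_apply]
  push_cast
  ring

theorem shift_linePsi_apply (i : ℕ) (t : ℝ) :
    shift (y0 ^ 2) linePsi i t = linePsi (t - 2 * i) + 2 * i := by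
  rw [shift, Equiv.Perm.mul_apply, Equiv.Perm.mul_apply, Equiv.Perm.inv_eq_iff_eq,
    y0_sq_pow_apply, y0_sq_pow_apply]
  ring

/-- Away from its own block, a shift of `linePsi` is the identity. -/
theorem shift_linePsi_of_ne {i b : ℕ} (hib : i ≠ b) {t : ℝ} (h1 : 2 * b - 1 ≤ t)
    (h2 : t < 2 * b + 1) : shift (y0 ^ 2) linePsi i t = t := by
  rw [shift_linePsi_apply, linePsi_apply]
  rcases hib.lt_or_gt with h | h
  · have : (i : ℝ) + 1 ≤ b := by exact_mod_cast h
    split_ifs <;> linarith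
  · have : (b : ℝ) + 1 ≤ i := by exact_mod_cast h
    split_ifs <;> linarith

theorem prod_shift_linePsi_left (L : List ℕ) (b : ℕ) {u : ℝ} (h0 : 0 ≤ u) (h1 : u < 1) :
    (L.map (shift (y0 ^ 2) linePsi)).prod (2 * b - 1 + u) =
      2 * b - 1 + 2 ^ (-(L.count b : ℤ)) * u := by
  induction L with
  | nil => simp
  | cons i L ih =>
    have hp : (2 : ℝ) ^ (-(L.count b : ℤ)) ≤ 1 := zpow_le_one_of_nonpos₀ one_le_two (by simp)
    have h2 : (2 : ℝ) ^ (-(L.count b : ℤ)) * u < 1 := by nlinarith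
    have h3 : 0 ≤ (2 : ℝ) ^ (-(L.count b : ℤ)) * u := by positivity
    rw [List.map_cons, List.prod_cons, Equiv.Perm.mul_apply, ih]
    rcases eq_or_ne i b with rfl | h
    · rw [List.count_cons_self, Nat.cast_succ, neg_add, zpow_add₀ two_ne_zero,
        zpow_neg_one, shift_linePsi_apply, linePsi_apply]
      split_ifs <;> linarith
    · rw [List.count_cons_of_ne h, shift_linePsi_of_ne h (by linarith) (by linarith)]

theorem prod_shift_linePsi_right (L : List ℕ) (b : ℕ) {u : ℝ} (h0 : 0 < u)
    (h1 : 2 ^ L.count b * u ≤ 1) :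
    (L.map (shift (y0 ^ 2) linePsi)).prod (2 * b + 1 - u) =
      2 * b + 1 - 2 ^ L.count b * u := by
  induction L with
  | nil => simp
  | cons i L ih =>
    rw [List.map_cons, List.prod_cons, Equiv.Perm.mul_apply]
    have h3 : 0 < (2 : ℝ) ^ L.count b * u := by positivity
    rcases eq_or_ne i b with rfl | h
    · rw [List.count_cons_self, pow_succ (2 : ℝ)] at h1 ⊢
      rw [ih (by linarith), shift_linePsi_apply, linePsi_apply]
      split_ifs <;> linarith
    · rw [List.count_cons_of_ne h] at h1 ⊢
      rw [ih h1, shift_linePsi_of_ne h (by linarith) (by linarith)]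

theorem hasRightSlope_left (L : List ℕ) (b : ℕ) :
    HasRightSlope (L.map (shift (y0 ^ 2) linePsi)).prod (2 * b - 1) (-(L.count b : ℤ)) := by
  refine ⟨1, one_pos, fun u h0 h1 => ?_⟩
  have := prod_shift_linePsi_left L b le_rfl one_pos
  rw [prod_shift_linePsi_left L b h0 h1]
  simp only [add_zero, mul_zero] at this
  rw [this]

theorem hasRightSlope_right (L : List ℕ) (b : ℕ) :
    HasRightSlope (L.map (shift (y0 ^ 2) linePsi)).prod (2 * b + 1 - 1 / 2 ^ L.length)
      (L.count b : ℤ) := by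
  have hε : (0 : ℝ) < 1 / 2 ^ L.length := by positivity
  have hle : (2 : ℝ) ^ L.count b * (1 / 2 ^ L.length) ≤ 1 := by
    rw [mul_one_div]
    exact div_le_one_of_le₀ (pow_le_pow_right₀ one_le_two List.count_le_length) (by positivity)
  refine ⟨_, hε, fun u h0 h1 => ?_⟩
  have hp : (0 : ℝ) < 2 ^ L.count b := by positivity
  rw [prod_shift_linePsi_right L b hε hle, sub_add,
    prod_shift_linePsi_right L b (by linarith) (by nlinarith), zpow_natCast]
  ring

/-- The endpoints of the blocks `[2 * b - 1, 2 * b + 1)`, the right ones moved to the left by `ε`. -/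
def samplePoint (ε : ℝ) (i : ℕ) : ℝ := if Even i then i - 1 else i - ε

theorem samplePoint_monotone {ε : ℝ} (h0 : 0 ≤ ε) (h1 : ε ≤ 1) : Monotone (samplePoint ε) := by
  refine monotone_nat_of_le_succ fun i => ?_
  rcases Nat.even_or_odd i with h | h
  · rw [samplePoint, samplePoint, if_pos h, if_neg (by simpa [Nat.even_add_one] using h)]
    push_cast
    linarith
  · have h' : Even (i + 1) := h.add_one
    rw [samplePoint, samplePoint, if_neg (by simpa using h), if_pos h']
    push_cast
    linarith

theorem sum_abs_sub_alternating (s : ℕ → ℤ) (c : ℕ → ℕ) (M : ℕ) (hl : ∀ b, s (2 * b) = -c b)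
    (hr : ∀ b, s (2 * b + 1) = c b) :
    ∑ i ∈ Finset.range (2 * M), |s (i + 1) - s i| =
      4 * ∑ b ∈ Finset.range M, (c b : ℤ) - c 0 + c M := by
  induction M with
  | zero => simp
  | succ M ih =>
    have e1 : |s (2 * M + 1) - s (2 * M)| = 2 * c M := by
      rw [hr, hl, abs_of_nonneg (by omega)]
      ring
    have e2 : |s (2 * M + 1 + 1) - s (2 * M + 1)| = c M + c (M + 1) := by
      rw [hr, show 2 * M + 1 + 1 = 2 * (M + 1) by ring, hl, abs_of_nonpos (by omega)]
      ring
    rw [Nat.mul_succ, Finset.sum_range_succ, Finset.sum_range_succ, ih, e1, e2,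
      Finset.sum_range_succ]
    ring

theorem eq_add_of_commute_y0_sq {Z : Equiv.Perm ℝ} {a b : ℝ} (hZ : Commute Z (y0 ^ 2))
    (ht : ∀ t, b ≤ t → Z t = t + a) (t : ℝ) : Z t = t + a := by
  obtain ⟨i, hi⟩ := exists_nat_ge (b - t)
  have h := congrArg (fun G : Equiv.Perm ℝ => G (t + 2 * i)) (hZ.pow_right i).eq
  simp only [Equiv.Perm.mul_apply, y0_sq_pow_apply] at h
  have h0 : (0 : ℝ) ≤ i := Nat.cast_nonneg i
  rw [ht (t + 2 * i) (by linarith), add_sub_cancel_right] at h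
  linarith

theorem lineAction_tent (k : ℕ) : LineAction (tent (x0 ^ 2) psi k) (tent (y0 ^ 2) linePsi k) := by
  rw [tent, tent]
  induction tentIndices k with
  | nil => exact lineAction_one
  | cons i L ih =>
    have hS := (lineAction_x0.pow 2).pow i
    exact ((hS.inv.mul lineAction_psi).mul hS).mul ih

theorem hasWord_x0 : HasWord x0 1 := .of_mem (by simp)

theorem hasWord_x1 : HasWord x1 1 := .of_mem (by simp)

theorem psi_mem : psi ∈ ThompsonF :=
  (((hasWord_x0.mul hasWord_x1).mul hasWord_x0.inv).mul hasWord_x1.inv).mem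

theorem tent_mem (k : ℕ) : tent (x0 ^ 2) psi k ∈ ThompsonF := by
  refine Subgroup.list_prod_mem _ fun g hg => ?_
  obtain ⟨i, -, rfl⟩ := List.mem_map.1 hg
  have hS : (x0 ^ 2) ^ i ∈ ThompsonF := pow_mem (pow_mem hasWord_x0.mem 2) i
  exact mul_mem (mul_mem (inv_mem hS) psi_mem) hS

theorem hasWord_tent_conj (m : ℕ) :
    HasWord (tent (x0 ^ 2) psi (m + 1) * x0 ^ 2 * (tent (x0 ^ 2) psi (m + 1))⁻¹)
      (12 * (m + 1) - 2) := by
  have hS := hasWord_x0.pow 2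
  have hB : HasWord ((x0 ^ 2)⁻¹ * psi) 4 := by
    have : (x0 ^ 2)⁻¹ * psi = x0⁻¹ * x1 * x0⁻¹ * x1⁻¹ := by
      rw [psi]
      group
    rw [this]
    exact ((hasWord_x0.inv.mul hasWord_x1).mul hasWord_x0.inv).mul hasWord_x1.inv
  rw [tent_conj _ _ commute_shift_psi]
  convert (((hS.inv.pow m).mul (hB.pow (m + 1))).mul (hS.pow (m + 1))).mul (hB.inv.pow (m + 1))
    using 1
  omega

theorem le_wordLength_of_conj {k : ℕ} {h : Equiv.Perm ℝ} (hF : h ∈ ThompsonF)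
    (hc : h⁻¹ * (tent (x0 ^ 2) psi k * x0 ^ 2 * (tent (x0 ^ 2) psi k)⁻¹) * h = x0 ^ 2) :
    2 * (k * k) ≤ wordLength h := by
  obtain ⟨G, hG, -, -, s, hs, hvar⟩ := (hasWord_wordLength hF).exists_lineModel
  obtain ⟨Z, hZ, -, ⟨a, b, hab⟩, -⟩ :=
    (hasWord_wordLength (mul_mem (inv_mem (tent_mem k)) hF)).exists_lineModel
  have hcomm : Commute Z (y0 ^ 2) := by
    have hS := lineAction_x0.pow 2
    refine (hZ.mul hS).unique ?_
    convert hS.mul hZ using 1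
    exact mul_eq_mul_of_conj hc
  have hZa := eq_add_of_commute_y0_sq hcomm hab
  have hGt (t : ℝ) : G t = tent (y0 ^ 2) linePsi k (t + a) := by
    have : LineAction h (tent (y0 ^ 2) linePsi k * Z) := by
      simpa using (lineAction_tent k).mul hZ
    rw [hG.unique this, Equiv.Perm.mul_apply, hZa]
  have slope {t : ℝ} {r : ℤ} (ht : HasRightSlope (tent (y0 ^ 2) linePsi k : Equiv.Perm ℝ) t r) :
      s (t - a) = r := by
    refine (hs _).unique ?_
    obtain ⟨ε, hε, H⟩ := ht
    refine ⟨ε, hε, fun u h0 h1 => ?_⟩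
    rw [hGt, hGt, sub_add_cancel, ← H u h0 h1]
    congr 1
    ring
  let L := tentIndices k
  let ε : ℝ := 1 / 2 ^ L.length
  have hε1 : ε ≤ 1 := div_le_one_of_le₀ (one_le_pow₀ one_le_two) (by positivity)
  have hmono : Monotone fun i => samplePoint ε i - a := fun i j hij =>
    sub_le_sub_right (samplePoint_monotone (by positivity) hε1 hij) a
  have key := hvar _ hmono (2 * (2 * k))
  rw [sum_abs_sub_alternating (fun i => s (samplePoint ε i - a)) (fun b => L.count b)] at key
  · have hsum : ∑ b ∈ Finset.range (2 * k), L.count b = k * k := by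
      rw [← length_tentIndices k]
      simpa using Multiset.sum_count_eq_card (s := Finset.range (2 * k)) (m := (L : Multiset ℕ))
        fun i hi => Finset.mem_range.2 (mem_tentIndices (by simpa using hi)).2
    have h0 : L.count 0 = 0 := List.count_eq_zero.2 fun hi => (mem_tentIndices hi).1.ne rfl
    rw [h0, ← Nat.cast_sum, hsum] at key
    push_cast at key
    omega
  · intro b
    refine slope ?_
    rw [samplePoint, if_pos (even_two_mul b)]
    push_cast
    exact hasRightSlope_left L b
  · intro b
    refine slope ?_
    rw [samplePoint, if_neg (by simp)]
    push_cast
    exact hasRightSlope_right L b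

theorem two_mul_sq_le_CLF {n k : ℕ} (hk : 0 < k) (hn : 12 * k ≤ n) : 2 * (k * k) ≤ CLF n := by
  obtain ⟨m, rfl⟩ := Nat.exists_eq_add_one_of_ne_zero hk.ne'
  set h := tent (x0 ^ 2) psi (m + 1)
  have hf := hasWord_tent_conj m
  have hg := hasWord_x0.pow 2
  have hconj : h⁻¹ * (h * x0 ^ 2 * h⁻¹) * h = x0 ^ 2 := by group
  refine le_trans ?_ (le_CLF hf.mem hg.mem ⟨h, tent_mem _, hconj⟩ ?_)
  · refine le_csInf ⟨_, h, tent_mem _, hconj, rfl⟩ ?_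
    rintro _ ⟨g, hgF, hgc, rfl⟩
    exact le_wordLength_of_conj hgF hgc
  · have := hf.wordLength_le
    have := hg.wordLength_le
    omega

theorem clf_explicit_lower_bound (n : ℕ) (hn : 38 ≤ n) :
    (((n : ℝ) - 15) ^ 2 + 412) / 128 ≤ (CLF n : ℝ) := by
  obtain ⟨k, hk, h1, h2⟩ : ∃ k, 3 ≤ k ∧ 12 * k ≤ n ∧ n ≤ 12 * k + 11 :=
    ⟨n / 12, by omega, by omega, by omega⟩
  have h := two_mul_sq_le_CLF (by omega) h1
  have h3 : (3 : ℝ) ≤ k := by exact_mod_cast hk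
  have h4 : (n : ℝ) ≤ 12 * k + 11 := by exact_mod_cast h2
  have h5 : (38 : ℝ) ≤ n := by exact_mod_cast hn
  have h6 : 2 * ((k : ℝ) * k) ≤ CLF n := by exact_mod_cast h
  nlinarith

end
end
end

section
/- For every integer n ≥ 2, the centralizer of fₙ in Thompson's group F is the cyclic subgroup generated by fₙ: every h ∈ F with h fₙ = fₙ h is an integer power of fₙ. -/
noncomputable section

open Set

noncomputable section

open Set

/-- The element `fₙ = x₀(x₁⁻¹x₀⁻¹x₁x₀⁻¹)^{n−1} x₁⁻² (x₀x₁x₀x₁⁻¹)^{n−1}` of `F`. -/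
def fEl (n : ℕ) : Equiv.Perm ℝ :=
  x0 * (x1⁻¹ * x0⁻¹ * x1 * x0⁻¹) ^ (n - 1) * x1⁻¹ ^ 2 * (x0 * x1 * x0 * x1⁻¹) ^ (n - 1)

/-- The element `gₙ = x₀(x₁⁻²x₀⁻¹x₁x₀⁻¹)^{n−1} x₁⁻² (x₀x₁x₀)^{n−1}` of `F`. -/
def gEl (n : ℕ) : Equiv.Perm ℝ :=
  x0 * (x1⁻¹ ^ 2 * x0⁻¹ * x1 * x0⁻¹) ^ (n - 1) * x1⁻¹ ^ 2 * (x0 * x1 * x0) ^ (n - 1)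


open Filter Topology

lemma x0_of_le_half {t : ℝ} (h₀ : 0 ≤ t) (h₁ : t ≤ 1 / 2) : x0 t = t / 2 := by
  change x0fun t = _
  unfold x0fun
  split_ifs <;> linarith

lemma x0_of_mem_middle {t : ℝ} (h₀ : 1 / 2 ≤ t) (h₁ : t ≤ 3 / 4) : x0 t = t - 1 / 4 := by
  change x0fun t = _
  unfold x0fun
  split_ifs <;> linarith

lemma x0_of_three_quarters_le {t : ℝ} (h₀ : 3 / 4 ≤ t) (h₁ : t ≤ 1) : x0 t = 2 * t - 1 := by
  change x0fun t = _
  unfold x0fun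
  split_ifs <;> linarith

lemma x0_inv_of_le_quarter {t : ℝ} (h₀ : 0 ≤ t) (h₁ : t ≤ 1 / 4) : x0⁻¹ t = 2 * t := by
  change x0inv t = _
  unfold x0inv
  split_ifs <;> linarith

lemma x0_inv_of_mem_middle {t : ℝ} (h₀ : 1 / 4 ≤ t) (h₁ : t ≤ 1 / 2) :
    x0⁻¹ t = t + 1 / 4 := by
  change x0inv t = _
  unfold x0inv
  split_ifs <;> linarith

lemma x0_inv_of_half_le {t : ℝ} (h₀ : 1 / 2 ≤ t) (h₁ : t ≤ 1) : x0⁻¹ t = (t + 1) / 2 := by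
  change x0inv t = _
  unfold x0inv
  split_ifs <;> linarith

lemma x1_of_le_half {t : ℝ} (h₁ : t ≤ 1 / 2) : x1 t = t := by
  change x1fun t = _
  unfold x1fun
  split_ifs <;> linarith

lemma x1_of_le_three_quarters {t : ℝ} (h₀ : 1 / 2 ≤ t) (h₁ : t ≤ 3 / 4) :
    x1 t = t / 2 + 1 / 4 := by
  change x1fun t = _
  unfold x1fun
  split_ifs <;> linarith

lemma x1_of_le_seven_eighths {t : ℝ} (h₀ : 3 / 4 ≤ t) (h₁ : t ≤ 7 / 8) :
    x1 t = t - 1 / 8 := by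
  change x1fun t = _
  unfold x1fun
  split_ifs <;> linarith

lemma x1_of_seven_eighths_le {t : ℝ} (h₀ : 7 / 8 ≤ t) (h₁ : t ≤ 1) : x1 t = 2 * t - 1 := by
  change x1fun t = _
  unfold x1fun
  split_ifs <;> linarith

lemma x1_inv_of_le_half {t : ℝ} (h₁ : t ≤ 1 / 2) : x1⁻¹ t = t := by
  change x1inv t = _
  unfold x1inv
  split_ifs <;> linarith

lemma x1_inv_of_le_five_eighths {t : ℝ} (h₀ : 1 / 2 ≤ t) (h₁ : t ≤ 5 / 8) :
    x1⁻¹ t = 2 * t - 1 / 2 := by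
  change x1inv t = _
  unfold x1inv
  split_ifs <;> linarith

lemma x1_inv_of_le_three_quarters {t : ℝ} (h₀ : 5 / 8 ≤ t) (h₁ : t ≤ 3 / 4) :
    x1⁻¹ t = t + 1 / 8 := by
  change x1inv t = _
  unfold x1inv
  split_ifs <;> linarith

lemma x1_inv_of_three_quarters_le {t : ℝ} (h₀ : 3 / 4 ≤ t) (h₁ : t ≤ 1) :
    x1⁻¹ t = (t + 1) / 2 := by
  change x1inv t = _
  unfold x1inv
  split_ifs <;> linarith

/-- The left factor in the recursion `fEl (n + 1) = leftStep * fEl n * rightStep`. -/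
def leftStep : Equiv.Perm ℝ := x0 * (x1⁻¹ * x0⁻¹ * x1 * x0⁻¹) * x0⁻¹

/-- The right factor in the recursion `fEl (n + 1) = leftStep * fEl n * rightStep`. -/
def rightStep : Equiv.Perm ℝ := x0 * x1 * x0 * x1⁻¹

lemma fEl_one : fEl 1 = x0 * x1⁻¹ ^ 2 := by
  simp [fEl]

lemma fEl_add_two (n : ℕ) : fEl (n + 2) = leftStep * fEl (n + 1) * rightStep := by
  simp only [fEl, leftStep, rightStep, Nat.add_sub_cancel, show n + 2 - 1 = n + 1 by omega]
  rw [pow_succ' (x1⁻¹ * x0⁻¹ * x1 * x0⁻¹), pow_succ (x0 * x1 * x0 * x1⁻¹)]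
  simp only [mul_assoc, inv_mul_cancel_left]

lemma rightStep_of_le_half {t : ℝ} (h₀ : 0 ≤ t) (h₁ : t ≤ 1 / 2) : rightStep t = t / 4 := by
  simp only [rightStep, Equiv.Perm.mul_apply]
  simp (disch := grind) only [x1_inv_of_le_half, x0_of_le_half, x1_of_le_half]
  ring

lemma rightStep_of_mem_middle {t : ℝ} (h₀ : 1 / 2 ≤ t) (h₁ : t ≤ 7 / 8) :
    rightStep t = t - 3 / 8 := by
  simp only [rightStep, Equiv.Perm.mul_apply]
  rcases le_total t (5 / 8) with h | h
  · simp (disch := grind) only [x1_inv_of_le_five_eighths, x0_of_mem_middle, x1_of_le_half,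
      x0_of_le_half]
    ring
  rcases le_total t (3 / 4) with h' | h'
  · simp (disch := grind) only [x1_inv_of_le_three_quarters, x0_of_three_quarters_le,
      x1_of_le_three_quarters, x0_of_mem_middle]
    ring
  · simp (disch := grind) only [x1_inv_of_three_quarters_le, x0_of_three_quarters_le,
      x1_of_le_seven_eighths, x0_of_mem_middle]
    ring

lemma rightStep_of_seven_eighths_le {t : ℝ} (h₀ : 7 / 8 ≤ t) (h₁ : t ≤ 1) :
    rightStep t = 4 * t - 3 := by
  simp only [rightStep, Equiv.Perm.mul_apply]
  simp (disch := grind) only [x1_inv_of_three_quarters_le, x0_of_three_quarters_le,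
    x1_of_seven_eighths_le]
  ring

lemma leftStep_of_le_sixteenth {t : ℝ} (h₀ : 0 ≤ t) (h₁ : t ≤ 1 / 16) : leftStep t = 4 * t := by
  simp only [leftStep, Equiv.Perm.mul_apply]
  simp (disch := grind) only [x0_inv_of_le_quarter, x1_of_le_half, x1_inv_of_le_half,
    x0_of_le_half]
  ring

lemma leftStep_of_le_eighth {t : ℝ} (h₀ : 1 / 16 ≤ t) (h₁ : t ≤ 1 / 8) :
    leftStep t = 8 * t - 1 / 4 := by
  simp only [leftStep, Equiv.Perm.mul_apply]
  rcases le_total t (3 / 32) with h | h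
  · simp (disch := grind) only [x0_inv_of_le_quarter, x0_inv_of_mem_middle, x1_of_le_half,
      x1_inv_of_le_five_eighths, x0_of_mem_middle]
    ring
  · simp (disch := grind) only [x0_inv_of_le_quarter, x0_inv_of_mem_middle, x1_of_le_half,
      x1_inv_of_le_three_quarters, x0_of_three_quarters_le]
    ring

lemma leftStep_of_le_quarter {t : ℝ} (h₀ : 1 / 8 ≤ t) (h₁ : t ≤ 1 / 4) :
    leftStep t = t / 2 + 11 / 16 := by
  simp only [leftStep, Equiv.Perm.mul_apply]
  simp (disch := grind) only [x0_inv_of_le_quarter, x0_inv_of_mem_middle, x0_inv_of_half_le,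
    x1_of_le_three_quarters, x1_inv_of_three_quarters_le, x0_of_three_quarters_le]
  ring

lemma leftStep_of_quarter_le {t : ℝ} (h₀ : 1 / 4 ≤ t) (h₁ : t ≤ 1) :
    leftStep t = t / 4 + 3 / 4 := by
  simp only [leftStep, Equiv.Perm.mul_apply]
  rcases le_total t (1 / 2) with h | h
  · simp (disch := grind) only [x0_inv_of_mem_middle, x0_inv_of_half_le,
      x1_of_le_seven_eighths, x1_inv_of_three_quarters_le, x0_of_three_quarters_le]
    ring
  · simp (disch := grind) only [x0_inv_of_half_le,
      x1_of_seven_eighths_le, x1_inv_of_three_quarters_le, x0_of_three_quarters_le]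
    ring

/-- The ring `ℤ[1/2]` of dyadic rationals, inside `ℝ`. -/
def dyadic : Subring ℝ where
  carrier := {t | ∃ (k : ℕ) (m : ℤ), t * 2 ^ k = m}
  mul_mem' := by
    rintro a b ⟨k, m, h⟩ ⟨l, p, h'⟩
    refine ⟨k + l, m * p, ?_⟩
    push_cast
    rw [← h, ← h']
    ring
  one_mem' := ⟨0, 1, by simp⟩
  add_mem' := by
    rintro a b ⟨k, m, h⟩ ⟨l, p, h'⟩
    refine ⟨k + l, m * 2 ^ l + p * 2 ^ k, ?_⟩
    push_cast
    rw [← h, ← h']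
    ring
  zero_mem' := ⟨0, 0, by simp⟩
  neg_mem' := by
    rintro a ⟨k, m, h⟩
    exact ⟨k, -m, by push_cast; rw [← h]; ring⟩

lemma mem_dyadic_of_eight_mul {t y : ℝ} (ht : t ∈ dyadic) (a b : ℤ) (h : 8 * y = a * t + b) :
    y ∈ dyadic := by
  obtain ⟨k, m, hk⟩ := ht
  refine ⟨k + 3, a * m + b * 2 ^ k, ?_⟩
  push_cast
  rw [← hk]
  linear_combination 2 ^ k * h

lemma mem_dyadic_of_eight_mul_eq {y : ℝ} (b : ℤ) (h : 8 * y = b) : y ∈ dyadic :=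
  mem_dyadic_of_eight_mul dyadic.zero_mem 0 b (by simpa using h)

lemma three_dvd_of_mem_dyadic {y : ℝ} (hy : y ∈ dyadic) {c : ℤ} (h : 24 * y = c) : 3 ∣ c := by
  obtain ⟨k, m, hk⟩ := hy
  have hc : c * 2 ^ k = 24 * m := by
    have : (c * 2 ^ k : ℝ) = 24 * m := by rw [← hk, ← h]; ring
    exact_mod_cast this
  have hdvd : (3 : ℤ) ∣ c * 2 ^ k := hc ▸ ⟨8 * m, by ring⟩
  refine (IsCoprime.pow_right ?_).dvd_of_dvd_mul_right hdvd
  exact ⟨1, -1, by norm_num⟩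

/-- Near `p`, along the filter `l p`, the map `g` is affine with slope `2 ^ k`. -/
def HasAffineGerm (l : ℝ → Filter ℝ) (g : Equiv.Perm ℝ) (k : ℤ) (p : ℝ) : Prop :=
  ∀ᶠ s in l p, g s = g p + 2 ^ k * (s - p)

/-- Affine maps with slope a power of two are compatible with the family of filters `l`. -/
def AffineStable (l : ℝ → Filter ℝ) : Prop :=
  ∀ (p q : ℝ) (k : ℤ), Tendsto (fun s => q + (2 : ℝ) ^ k * (s - p)) (l p) (l q)

lemma affineStable_nhds : AffineStable 𝓝 := by
  intro p q k
  have h : Continuous fun s : ℝ => q + (2 : ℝ) ^ k * (s - p) := by fun_prop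
  simpa using h.tendsto p

lemma affineStable_nhdsGE : AffineStable fun p => 𝓝[≥] p := by
  intro p q k
  refine tendsto_nhdsWithin_iff.2 ⟨(affineStable_nhds p q k).mono_left nhdsWithin_le_nhds, ?_⟩
  filter_upwards [self_mem_nhdsWithin] with s hs
  have : (0 : ℝ) ≤ 2 ^ k * (s - p) := mul_nonneg (by positivity) (sub_nonneg.2 hs)
  simpa using this

lemma perm_apply_inv_self {α : Type*} (e : Equiv.Perm α) (x : α) : e (e⁻¹ x) = x :=
  e.apply_symm_apply x

lemma perm_inv_apply_self {α : Type*} (e : Equiv.Perm α) (x : α) : e⁻¹ (e x) = x :=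
  e.symm_apply_apply x

namespace HasAffineGerm

variable {l : ℝ → Filter ℝ} {g h : Equiv.Perm ℝ} {k j : ℤ} {p : ℝ}

lemma one : HasAffineGerm l 1 0 p :=
  Eventually.of_forall fun s => by simp

lemma mul (hl : AffineStable l) (hg : HasAffineGerm l g k (h p)) (hh : HasAffineGerm l h j p) :
    HasAffineGerm l (g * h) (k + j) p := by
  filter_upwards [hh, (hl p (h p) j).eventually hg] with s hs hs'
  rw [Equiv.Perm.mul_apply, Equiv.Perm.mul_apply, hs, hs', zpow_add₀ two_ne_zero]
  ring

lemma inv (hl : AffineStable l) (hg : HasAffineGerm l g k p) :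
    HasAffineGerm l g⁻¹ (-k) (g p) := by
  filter_upwards [(hl (g p) p (-k)).eventually hg] with s hs
  rw [Equiv.Perm.inv_eq_iff_eq, perm_inv_apply_self, hs, add_sub_cancel_left, ← mul_assoc,
    ← zpow_add₀ two_ne_zero]
  simp

lemma zpow (hl : AffineStable l) (hp : g p = p) (hg : HasAffineGerm l g k p) (m : ℤ) :
    HasAffineGerm l (g ^ m) (m * k) p := by
  induction m with
  | zero => simpa using one
  | succ m ih =>
    rw [zpow_add_one, add_mul, one_mul]
    exact mul hl (by rwa [hp]) hg
  | pred m ih =>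
    rw [zpow_sub_one, sub_mul, one_mul, sub_eq_add_neg]
    have hi : HasAffineGerm l g⁻¹ (-k) p := by simpa only [hp] using inv hl hg
    have hp' : g⁻¹ p = p := by rw [Equiv.Perm.inv_eq_iff_eq, hp]
    exact mul hl (by rwa [hp']) hi

lemma of_Ioo {a b c : ℝ} (hp : p ∈ Ioo a b) (k : ℤ)
    (hg : ∀ s, a < s → s < b → g s = 2 ^ k * s + c) : HasAffineGerm 𝓝 g k p := by
  filter_upwards [Ioo_mem_nhds hp.1 hp.2] with s hs
  rw [hg s hs.1 hs.2, hg p hp.1 hp.2]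
  ring

end HasAffineGerm

/-- The properties of the elements of Thompson's group used below: they are increasing, supported
on `[0,1]`, preserve the dyadic rationals, and are affine with slope a power of two near every
non-dyadic point and to the right of `0`. -/
structure IsThompsonLike (g : Equiv.Perm ℝ) : Prop where
  strictMono : StrictMono g
  apply_of_le_zero : ∀ t ≤ 0, g t = t
  apply_of_one_le : ∀ t, 1 ≤ t → g t = t
  mem_dyadic_iff : ∀ t, g t ∈ dyadic ↔ t ∈ dyadic
  germ : ∀ p ∉ dyadic, ∃ k, HasAffineGerm 𝓝 g k p
  germ_zero : ∃ k, HasAffineGerm (fun p => 𝓝[≥] p) g k 0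

namespace IsThompsonLike

variable {g h : Equiv.Perm ℝ}

lemma one : IsThompsonLike 1 where
  strictMono := strictMono_id
  apply_of_le_zero _ _ := rfl
  apply_of_one_le _ _ := rfl
  mem_dyadic_iff _ := Iff.rfl
  germ _ _ := ⟨0, .one⟩
  germ_zero := ⟨0, .one⟩

lemma mul (hg : IsThompsonLike g) (hh : IsThompsonLike h) : IsThompsonLike (g * h) where
  strictMono := hg.strictMono.comp hh.strictMono
  apply_of_le_zero t ht := by
    rw [Equiv.Perm.mul_apply, hh.apply_of_le_zero t ht, hg.apply_of_le_zero t ht]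
  apply_of_one_le t ht := by
    rw [Equiv.Perm.mul_apply, hh.apply_of_one_le t ht, hg.apply_of_one_le t ht]
  mem_dyadic_iff t := (hg.mem_dyadic_iff (h t)).trans (hh.mem_dyadic_iff t)
  germ p hp := by
    obtain ⟨j, hj⟩ := hh.germ p hp
    obtain ⟨k, hk⟩ := hg.germ (h p) (mt (hh.mem_dyadic_iff p).1 hp)
    exact ⟨k + j, .mul affineStable_nhds hk hj⟩
  germ_zero := by
    obtain ⟨j, hj⟩ := hh.germ_zero
    obtain ⟨k, hk⟩ := hg.germ_zero
    exact ⟨k + j, .mul affineStable_nhdsGE (by rwa [hh.apply_of_le_zero 0 le_rfl]) hj⟩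

lemma inv (hg : IsThompsonLike g) : IsThompsonLike g⁻¹ where
  strictMono a b hab := by
    rw [← hg.strictMono.lt_iff_lt]
    simpa using hab
  apply_of_le_zero t ht := by rw [Equiv.Perm.inv_eq_iff_eq, hg.apply_of_le_zero t ht]
  apply_of_one_le t ht := by rw [Equiv.Perm.inv_eq_iff_eq, hg.apply_of_one_le t ht]
  mem_dyadic_iff t := by rw [← hg.mem_dyadic_iff, perm_apply_inv_self]
  germ p hp := by
    obtain ⟨k, hk⟩ := hg.germ (g⁻¹ p) (by rwa [← hg.mem_dyadic_iff, perm_apply_inv_self])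
    exact ⟨-k, by simpa only [perm_apply_inv_self] using hk.inv affineStable_nhds⟩
  germ_zero := by
    obtain ⟨k, hk⟩ := hg.germ_zero
    refine ⟨-k, ?_⟩
    simpa only [hg.apply_of_le_zero 0 le_rfl] using hk.inv affineStable_nhdsGE

end IsThompsonLike

lemma x0_strictMono : StrictMono x0 := by
  intro a b hab
  change x0fun a < x0fun b
  unfold x0fun
  split_ifs <;> linarith

lemma x1_strictMono : StrictMono x1 := by
  intro a b hab
  change x1fun a < x1fun b
  unfold x1fun
  split_ifs <;> linarith

lemma x0_of_le_zero {t : ℝ} (ht : t ≤ 0) : x0 t = t := by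
  change x0fun t = _
  unfold x0fun
  split_ifs <;> linarith

lemma x0_of_one_le {t : ℝ} (ht : 1 ≤ t) : x0 t = t := by
  change x0fun t = _
  unfold x0fun
  split_ifs <;> linarith

lemma x1_of_one_le {t : ℝ} (ht : 1 ≤ t) : x1 t = t := by
  change x1fun t = _
  unfold x1fun
  split_ifs <;> linarith

lemma x0_mem_dyadic {t : ℝ} (ht : t ∈ dyadic) : x0 t ∈ dyadic := by
  change x0fun t ∈ dyadic
  unfold x0fun
  split_ifs
  · exact ht
  · exact mem_dyadic_of_eight_mul ht 4 0 (by push_cast; ring)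
  · exact mem_dyadic_of_eight_mul ht 8 (-2) (by push_cast; ring)
  · exact mem_dyadic_of_eight_mul ht 16 (-8) (by push_cast; ring)
  · exact ht

lemma x0_inv_mem_dyadic {t : ℝ} (ht : t ∈ dyadic) : x0⁻¹ t ∈ dyadic := by
  change x0inv t ∈ dyadic
  unfold x0inv
  split_ifs
  · exact ht
  · exact mem_dyadic_of_eight_mul ht 16 0 (by push_cast; ring)
  · exact mem_dyadic_of_eight_mul ht 8 2 (by push_cast; ring)
  · exact mem_dyadic_of_eight_mul ht 4 4 (by push_cast; ring)
  · exact ht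

lemma x1_mem_dyadic {t : ℝ} (ht : t ∈ dyadic) : x1 t ∈ dyadic := by
  change x1fun t ∈ dyadic
  unfold x1fun
  split_ifs
  · exact ht
  · exact ht
  · exact mem_dyadic_of_eight_mul ht 4 2 (by push_cast; ring)
  · exact mem_dyadic_of_eight_mul ht 8 (-1) (by push_cast; ring)
  · exact mem_dyadic_of_eight_mul ht 16 (-8) (by push_cast; ring)
  · exact ht

lemma x1_inv_mem_dyadic {t : ℝ} (ht : t ∈ dyadic) : x1⁻¹ t ∈ dyadic := by
  change x1inv t ∈ dyadic
  unfold x1inv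
  split_ifs
  · exact ht
  · exact ht
  · exact mem_dyadic_of_eight_mul ht 16 (-4) (by push_cast; ring)
  · exact mem_dyadic_of_eight_mul ht 8 1 (by push_cast; ring)
  · exact mem_dyadic_of_eight_mul ht 4 4 (by push_cast; ring)
  · exact ht

/-- A non-dyadic point lies strictly to one side of every multiple of `1/8`. -/
lemma lt_or_gt_of_notMem_dyadic {p : ℝ} (hp : p ∉ dyadic) (c : ℤ) : p < c / 8 ∨ c / 8 < p :=
  lt_or_gt_of_ne fun h => hp (mem_dyadic_of_eight_mul_eq c (by rw [h]; ring))

lemma isThompsonLike_x0 : IsThompsonLike x0 where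
  strictMono := x0_strictMono
  apply_of_le_zero _ := x0_of_le_zero
  apply_of_one_le _ := x0_of_one_le
  mem_dyadic_iff t := ⟨fun h => by simpa using x0_inv_mem_dyadic h, x0_mem_dyadic⟩
  germ p hp := by
    rcases lt_or_gt_of_notMem_dyadic hp 0 with h₀ | h₀
    · refine ⟨0, .of_Ioo (a := p - 1) (b := 0) (c := 0) ⟨by linarith, by simpa using h₀⟩ 0 ?_⟩
      intro s _ hs
      rw [x0_of_le_zero hs.le]
      simp
    rcases lt_or_gt_of_notMem_dyadic hp 4 with h₁ | h₁
    · refine ⟨-1, .of_Ioo (c := 0) ⟨h₀, h₁⟩ (-1) ?_⟩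
      intro s hs hs'
      norm_num at hs hs' ⊢
      rw [x0_of_le_half hs.le hs'.le]
      ring
    rcases lt_or_gt_of_notMem_dyadic hp 6 with h₂ | h₂
    · refine ⟨0, .of_Ioo (c := -1 / 4) ⟨h₁, h₂⟩ 0 ?_⟩
      intro s hs hs'
      norm_num at hs hs' ⊢
      rw [x0_of_mem_middle hs.le hs'.le]
      ring
    rcases lt_or_gt_of_notMem_dyadic hp 8 with h₃ | h₃
    · refine ⟨1, .of_Ioo (c := -1) ⟨h₂, h₃⟩ 1 ?_⟩
      intro s hs hs'
      norm_num at hs hs' ⊢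
      rw [x0_of_three_quarters_le hs.le hs'.le]
      ring
    · refine ⟨0, .of_Ioo (b := p + 1) (c := 0) ⟨h₃, by linarith⟩ 0 ?_⟩
      intro s hs _
      norm_num at hs ⊢
      exact x0_of_one_le hs.le
  germ_zero := by
    refine ⟨-1, ?_⟩
    filter_upwards [Icc_mem_nhdsGE (show (0 : ℝ) < 1 / 2 by norm_num)] with s hs
    rw [x0_of_le_half hs.1 hs.2, x0_of_le_zero le_rfl]
    norm_num
    ring

lemma isThompsonLike_x1 : IsThompsonLike x1 where
  strictMono := x1_strictMono
  apply_of_le_zero t ht := x1_of_le_half (by linarith)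
  apply_of_one_le _ := x1_of_one_le
  mem_dyadic_iff t := ⟨fun h => by simpa using x1_inv_mem_dyadic h, x1_mem_dyadic⟩
  germ p hp := by
    rcases lt_or_gt_of_notMem_dyadic hp 4 with h₁ | h₁
    · refine ⟨0, .of_Ioo (a := p - 1) (c := 0) ⟨by linarith, h₁⟩ 0 ?_⟩
      intro s _ hs
      norm_num at hs ⊢
      exact x1_of_le_half hs.le
    rcases lt_or_gt_of_notMem_dyadic hp 6 with h₂ | h₂
    · refine ⟨-1, .of_Ioo (c := 1 / 4) ⟨h₁, h₂⟩ (-1) ?_⟩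
      intro s hs hs'
      norm_num at hs hs' ⊢
      rw [x1_of_le_three_quarters hs.le hs'.le]
      ring
    rcases lt_or_gt_of_notMem_dyadic hp 7 with h₃ | h₃
    · refine ⟨0, .of_Ioo (c := -1 / 8) ⟨h₂, h₃⟩ 0 ?_⟩
      intro s hs hs'
      norm_num at hs hs' ⊢
      rw [x1_of_le_seven_eighths hs.le hs'.le]
      ring
    rcases lt_or_gt_of_notMem_dyadic hp 8 with h₄ | h₄
    · refine ⟨1, .of_Ioo (c := -1) ⟨h₃, h₄⟩ 1 ?_⟩
      intro s hs hs'
      norm_num at hs hs' ⊢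
      rw [x1_of_seven_eighths_le hs.le hs'.le]
      ring
    · refine ⟨0, .of_Ioo (b := p + 1) (c := 0) ⟨h₄, by linarith⟩ 0 ?_⟩
      intro s hs _
      norm_num at hs ⊢
      exact x1_of_one_le hs.le
  germ_zero := by
    refine ⟨0, ?_⟩
    filter_upwards [Icc_mem_nhdsGE (show (0 : ℝ) < 1 / 2 by norm_num)] with s hs
    rw [x1_of_le_half hs.2, x1_of_le_half (by norm_num)]
    norm_num

lemma isThompsonLike_of_mem {g : Equiv.Perm ℝ} (hg : g ∈ ThompsonF) : IsThompsonLike g := by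
  induction hg using Subgroup.closure_induction with
  | mem g hg =>
    rcases hg with rfl | rfl
    exacts [isThompsonLike_x0, isThompsonLike_x1]
  | one => exact .one
  | mul g h _ _ hg hh => exact hg.mul hh
  | inv g _ hg => exact hg.inv

lemma x0_mem_ThompsonF : x0 ∈ ThompsonF := Subgroup.subset_closure (by simp)

lemma x1_mem_ThompsonF : x1 ∈ ThompsonF := Subgroup.subset_closure (by simp)

lemma fEl_mem_ThompsonF (n : ℕ) : fEl n ∈ ThompsonF := by
  have h₀ := x0_mem_ThompsonF
  have h₁ := x1_mem_ThompsonF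
  have h₀' := inv_mem h₀
  have h₁' := inv_mem h₁
  exact mul_mem (mul_mem (mul_mem h₀
    (pow_mem (mul_mem (mul_mem (mul_mem h₁' h₀') h₁) h₀') _)) (pow_mem h₁' _))
    (pow_mem (mul_mem (mul_mem (mul_mem h₀ h₁) h₀) h₁') _)

lemma fEl_of_le_half (n : ℕ) {t : ℝ} (h₀ : 0 ≤ t) (h₁ : t ≤ 1 / 2) : fEl (n + 1) t = t / 2 := by
  induction n generalizing t with
  | zero =>
    rw [zero_add, fEl_one, pow_two, Equiv.Perm.mul_apply, Equiv.Perm.mul_apply,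
      x1_inv_of_le_half h₁, x1_inv_of_le_half h₁, x0_of_le_half h₀ h₁]
  | succ n ih =>
    rw [fEl_add_two, Equiv.Perm.mul_apply, Equiv.Perm.mul_apply, rightStep_of_le_half h₀ h₁,
      ih (by linarith) (by linarith), leftStep_of_le_sixteenth (by linarith) (by linarith)]
    ring

/-- The affine map `4 * t - 7 / 4` has no dyadic fixed point. -/
lemma four_mul_sub_ne_of_mem_dyadic {t : ℝ} (ht : t ∈ dyadic) : 4 * t - 7 / 4 ≠ t := fun h => by
  have := three_dvd_of_mem_dyadic ht (c := 14) (by push_cast; linarith)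
  omega

/-- The affine map `t / 4 + 19 / 32` has no dyadic fixed point. -/
lemma div_four_add_ne_of_mem_dyadic {t : ℝ} (ht : t ∈ dyadic) : t / 4 + 19 / 32 ≠ t := fun h => by
  have := three_dvd_of_mem_dyadic ht (c := 19) (by push_cast; linarith)
  omega

lemma fEl_one_apply_ne {t : ℝ} (ht : t ∈ dyadic) (h₀ : 1 / 2 ≤ t) (h₁ : t < 1) :
    fEl 1 t ≠ t := by
  rw [fEl_one, pow_two, Equiv.Perm.mul_apply, Equiv.Perm.mul_apply]
  rcases le_total t (5 / 8) with h | h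
  · have key : x0 (x1⁻¹ (x1⁻¹ t)) = 4 * t - 7 / 4 := by
      rcases le_total t (9 / 16) with h' | h'
      · simp (disch := grind) only [x1_inv_of_le_five_eighths, x0_of_mem_middle]
        ring
      · simp (disch := grind) only [x1_inv_of_le_five_eighths, x1_inv_of_le_three_quarters,
          x0_of_three_quarters_le]
        ring
    rw [key]
    exact four_mul_sub_ne_of_mem_dyadic ht
  rcases le_total t (3 / 4) with h' | h'
  · simp (disch := grind) only [x1_inv_of_le_three_quarters, x1_inv_of_three_quarters_le,
      x0_of_three_quarters_le]
    intro h
    linarith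
  · simp (disch := grind) only [x1_inv_of_three_quarters_le, x0_of_three_quarters_le]
    intro h
    linarith

lemma fEl_apply_ne_of_half_le (n : ℕ) {t : ℝ} (ht : t ∈ dyadic) (h₀ : 1 / 2 ≤ t) (h₁ : t < 1) :
    fEl (n + 1) t ≠ t := by
  induction n generalizing t with
  | zero => exact fEl_one_apply_ne ht h₀ h₁
  | succ n ih =>
    rw [fEl_add_two, Equiv.Perm.mul_apply, Equiv.Perm.mul_apply]
    rcases le_total t (7 / 8) with h | h
    · rw [rightStep_of_mem_middle h₀ h, fEl_of_le_half n (by linarith) (by linarith)]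
      rcases le_total t (5 / 8) with h' | h'
      · rw [leftStep_of_le_eighth (by linarith) (by linarith)]
        convert four_mul_sub_ne_of_mem_dyadic ht using 1
        ring
      · rw [leftStep_of_le_quarter (by linarith) (by linarith)]
        convert div_four_add_ne_of_mem_dyadic ht using 1
        ring
    · have hf := isThompsonLike_of_mem (fEl_mem_ThompsonF (n + 1))
      have hlow : 1 / 4 ≤ fEl (n + 1) (4 * t - 3) := by
        have := hf.strictMono.monotone (show (1 / 2 : ℝ) ≤ 4 * t - 3 by linarith)
        rw [fEl_of_le_half n (by norm_num) le_rfl] at this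
        linarith
      have hhigh : fEl (n + 1) (4 * t - 3) ≤ 1 := by
        have := hf.strictMono.monotone (show 4 * t - 3 ≤ (1 : ℝ) by linarith)
        rwa [hf.apply_of_one_le 1 le_rfl] at this
      rw [rightStep_of_seven_eighths_le h h₁.le, leftStep_of_quarter_le hlow hhigh]
      intro heq
      exact ih (t := 4 * t - 3) (mem_dyadic_of_eight_mul ht 32 (-24) (by push_cast; ring))
        (by linarith) (by linarith) (by linarith)

lemma fEl_apply_ne (n : ℕ) {t : ℝ} (ht : t ∈ dyadic) (h₀ : 0 < t) (h₁ : t < 1) :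
    fEl (n + 1) t ≠ t := by
  rcases le_total t (1 / 2) with h | h
  · rw [fEl_of_le_half n h₀.le h]
    linarith
  · exact fEl_apply_ne_of_half_le n ht h h₁

/-- An element commuting with `f` and fixing everything to the left of `c` fixes everything to the
left of `f c`. -/
lemma apply_eq_self_of_lt_of_commute {f g : Equiv.Perm ℝ} (hf : StrictMono f) (hfg : Commute g f)
    {c : ℝ} (hg : ∀ s < c, g s = s) {s : ℝ} (hs : s < f c) : g s = s := by
  obtain ⟨r, rfl⟩ := f.surjective s
  have := congrArg (fun e : Equiv.Perm ℝ => e r) hfg.eq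
  simp only [Equiv.Perm.mul_apply] at this
  rw [this, hg r (hf.lt_iff_lt.1 hs)]

lemma apply_eq_self_of_forall_lt {g : Equiv.Perm ℝ} (hmono : StrictMono g) {c : ℝ}
    (hg : ∀ s < c, g s = s) : g c = c := by
  rcases lt_trichotomy (g c) c with h | h | h
  · exact g.injective (hg _ h)
  · exact h
  · obtain ⟨r, hr⟩ := g.surjective ((c + g c) / 2)
    have hrc : r < c := hmono.lt_iff_lt.1 (by linarith)
    rw [hg r hrc] at hr
    linarith

lemma eventually_eq_self_of_forall_lt {g : Equiv.Perm ℝ} (hmono : StrictMono g) {c : ℝ} {k : ℤ}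
    (hgerm : HasAffineGerm 𝓝 g k c) (hg : ∀ s < c, g s = s) : ∀ᶠ s in 𝓝 c, g s = s := by
  have hc := apply_eq_self_of_forall_lt hmono hg
  have hleft : ∀ᶠ s in 𝓝[<] c, g s = g c + 2 ^ k * (s - c) := hgerm.filter_mono nhdsWithin_le_nhds
  obtain ⟨s, hs, hsc⟩ := (hleft.and self_mem_nhdsWithin).exists
  have hsc : s < c := hsc
  rw [hg s hsc, hc] at hs
  have hk : (2 : ℝ) ^ k = 1 := by
    have : ((2 : ℝ) ^ k - 1) * (s - c) = 0 := by linarith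
    rcases mul_eq_zero.1 this with h | h <;> linarith
  filter_upwards [hgerm] with s hs
  rw [hs, hc, hk]
  ring

lemma eq_one_of_commute {f g : Equiv.Perm ℝ} (hf : IsThompsonLike f) (hg : IsThompsonLike g)
    (hfg : Commute g f) (hfix : ∀ t ∈ dyadic, 0 < t → t < 1 → f t ≠ t)
    (hzero : HasAffineGerm (fun p => 𝓝[≥] p) g 0 0) : g = 1 := by
  by_contra hne
  set S : Set ℝ := {s | g s ≠ s}
  have hS : S.Nonempty := by
    by_contra h
    exact hne (Equiv.ext fun s => by_contra fun hs => h ⟨s, hs⟩)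
  have hSpos : ∀ s ∈ S, 0 < s := fun s hs =>
    not_le.1 fun h => hs (hg.apply_of_le_zero s h)
  have hSbdd : BddBelow S := ⟨0, fun s hs => (hSpos s hs).le⟩
  set c := sInf S
  have hlt : ∀ s < c, g s = s := fun s hs => by_contra fun h => notMem_of_lt_csInf hs hSbdd h
  have hlower : ∀ d, (∀ s < d, g s = s) → d ≤ c := fun d hd =>
    le_csInf hS fun s hs => not_lt.1 fun h => hs (hd s h)
  have hc0 : 0 < c := by
    obtain ⟨e, he, hsub⟩ := mem_nhdsGE_iff_exists_Ico_subset.1 hzero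
    refine lt_of_lt_of_le he (hlower e fun s hs => ?_)
    rcases le_total s 0 with h | h
    · exact hg.apply_of_le_zero s h
    · have := hsub ⟨h, hs⟩
      simpa [hg.apply_of_le_zero 0 le_rfl] using this
  have hc1 : c < 1 := by
    obtain ⟨s, hs⟩ := hS
    exact (csInf_le hSbdd hs).trans_lt (not_le.1 fun h => hs (hg.apply_of_one_le s h))
  have hfc : f c = c := by
    refine le_antisymm
      (hlower _ fun s hs => apply_eq_self_of_lt_of_commute hf.strictMono hfg hlt hs) ?_
    have := hlower _ fun s hs =>
      apply_eq_self_of_lt_of_commute hf.inv.strictMono hfg.inv_right hlt hs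
    simpa using hf.strictMono.monotone this
  obtain ⟨k, hk⟩ := hg.germ c fun h => hfix c h hc0 hc1 hfc
  obtain ⟨e, he, hsub⟩ := mem_nhdsGE_iff_exists_Ico_subset.1 <|
    (eventually_eq_self_of_forall_lt hg.strictMono hk hlt).filter_mono
      (nhdsWithin_le_nhds (s := Ici c))
  refine (hlower e fun s hs => ?_).not_gt he
  rcases lt_or_ge s c with h | h
  · exact hlt s h
  · exact hsub ⟨h, hs⟩

theorem centralizer_of_fn_cyclic (n : ℕ) (hn : 2 ≤ n) :
    ∀ h ∈ ThompsonF, h * fEl n = fEl n * h → ∃ m : ℤ, h = fEl n ^ m := by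
  obtain ⟨n, rfl⟩ := Nat.exists_eq_add_of_le' (one_le_two.trans hn)
  intro h hh hcomm
  have hfmem := fEl_mem_ThompsonF (n + 1)
  have hf := isThompsonLike_of_mem hfmem
  have hf0 : fEl (n + 1) 0 = 0 := hf.apply_of_le_zero 0 le_rfl
  have hfgerm : HasAffineGerm (fun p => 𝓝[≥] p) (fEl (n + 1)) (-1) 0 := by
    filter_upwards [Icc_mem_nhdsGE (show (0 : ℝ) < 1 / 2 by norm_num)] with s hs
    rw [fEl_of_le_half n hs.1 hs.2, hf0]
    norm_num
    ring
  obtain ⟨k, hk⟩ := (isThompsonLike_of_mem hh).germ_zero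
  refine ⟨-k, ?_⟩
  rw [zpow_neg, ← mul_eq_one_iff_eq_inv]
  have hpow0 : (fEl (n + 1) ^ k) 0 = 0 :=
    (isThompsonLike_of_mem (zpow_mem hfmem k)).apply_of_le_zero 0 le_rfl
  refine eq_one_of_commute hf (isThompsonLike_of_mem (mul_mem hh (zpow_mem hfmem k)))
    (Commute.mul_left hcomm ((Commute.refl _).zpow_left k)) (fun t ht => fEl_apply_ne n ht) ?_
  have hmul := HasAffineGerm.mul affineStable_nhdsGE (g := h) (k := k) (by rwa [hpow0])
    (hfgerm.zpow affineStable_nhdsGE hf0 k)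
  simpa using hmul

end
end
end
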